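/- arXiv:1712.05100 — 3 statements merged into one kernel-verified Lean document; each statement's English description precedes it below -/
import Mathlib

section
/- Let h : Fin 2 → Fin 2 → Fin 2 → ℝ be totally symmetric (invariant under all permutations of its three indices). Define S := ∑_{β,i,j} (h β i j)², H^β := (1/2)·∑_i h β i i for β ∈ Fin 2, and H² := ∑_β (H^β)². If S = 2·H² (equivalently ρ² := S − 2H² vanishes), then h β i j = 0 for all β, i, j; in particular S = 0. -/
open Finset in
/-- If a totally symmetric 3-tensor `h` on a 2-dimensional space satisfies
`S = 2 H²` (i.e. `ρ² = S - 2H²` vanishes), where `S` is its squared length and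
`H^β = (1/2) ∑ᵢ h β i i` are the mean curvature components, then `h = 0`;
in particular `S = 0`. -/
theorem rho_sq_zero_implies_totally_geodesic
    (h : Fin 2 → Fin 2 → Fin 2 → ℝ)
    (hsymm1 : ∀ a b c, h a b c = h b a c)
    (hsymm2 : ∀ a b c, h a b c = h a c b)
    (S : ℝ) (hS : S = ∑ β : Fin 2, ∑ i : Fin 2, ∑ j : Fin 2, (h β i j) ^ 2)
    (H : Fin 2 → ℝ) (hH : ∀ β, H β = (1 / 2) * ∑ i : Fin 2, h β i i)
    (H2 : ℝ) (hH2 : H2 = ∑ β : Fin 2, (H β) ^ 2)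
    (hrho : S = 2 * H2) :
    (∀ β i j, h β i j = 0) ∧ S = 0 := by
  have h010 : h 0 1 0 = h 0 0 1 := hsymm2 0 1 0
  have h100 : h 1 0 0 = h 0 0 1 := (hsymm1 1 0 0).trans h010
  have h101 : h 1 0 1 = h 0 1 1 := hsymm1 1 0 1
  have h110 : h 1 1 0 = h 0 1 1 := (hsymm2 1 1 0).trans h101
  -- `S - 2 H²` is a positive definite sum of squares in the four independent components.
  have hsos : (h 0 0 0 - h 0 1 1) ^ 2 + 4 * h 0 1 1 ^ 2
      + (h 1 1 1 - h 0 0 1) ^ 2 + 4 * h 0 0 1 ^ 2 = 0 := by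
    rw [hS, hH2] at hrho
    simp only [hH, Fin.sum_univ_two, h010, h100, h101, h110] at hrho
    linarith
  have h011 : h 0 1 1 = 0 := by
    refine pow_eq_zero_iff two_ne_zero |>.mp ?_
    nlinarith [sq_nonneg (h 0 0 0 - h 0 1 1), sq_nonneg (h 0 1 1),
      sq_nonneg (h 1 1 1 - h 0 0 1), sq_nonneg (h 0 0 1)]
  have h001 : h 0 0 1 = 0 := by
    refine pow_eq_zero_iff two_ne_zero |>.mp ?_
    nlinarith [sq_nonneg (h 0 0 0 - h 0 1 1), sq_nonneg (h 0 1 1),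
      sq_nonneg (h 1 1 1 - h 0 0 1), sq_nonneg (h 0 0 1)]
  rw [h011, h001] at hsos
  have h000 : h 0 0 0 = 0 := by
    refine pow_eq_zero_iff two_ne_zero |>.mp ?_
    nlinarith [sq_nonneg (h 0 0 0), sq_nonneg (h 1 1 1)]
  have h111 : h 1 1 1 = 0 := by
    refine pow_eq_zero_iff two_ne_zero |>.mp ?_
    nlinarith [sq_nonneg (h 0 0 0), sq_nonneg (h 1 1 1)]
  have hzero : ∀ β i j, h β i j = 0 := by
    simp [Fin.forall_fin_two, h000, h001, h010, h011, h100, h101, h110, h111]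
  exact ⟨hzero, by simp [hS, hzero]⟩
end

section
/- Let T : Fin 2 → Fin 2 → Fin 2 → Fin 2 → ℝ be such that for each fixed first index s, the 3-tensor (i,j,k) ↦ T s i j k is totally symmetric (invariant under all permutations of i, j, k). Define H^s_i := (1/2)·∑_k T s k k i. Then ∑_{s,i,j,k} (T s i j k)² ≥ 3·∑_{s,i} (H^s_i)². -/
open Finset in
/-- The algebraic inequality `|∇ᵀh|² ≥ 3 |∇ᵀH|²`: if `T s · · ·` is totally
symmetric in its last three indices for each `s`, and `H s i = (1/2) ∑ₖ T s k k i`,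
then `∑ (T s i j k)² ≥ 3 ∑ (H s i)²`. -/
theorem norm_sq_nabla_h_ge_three_norm_sq_nabla_H
    (T : Fin 2 → Fin 2 → Fin 2 → Fin 2 → ℝ)
    (hsymm1 : ∀ s a b c, T s a b c = T s b a c)
    (hsymm2 : ∀ s a b c, T s a b c = T s a c b)
    (H : Fin 2 → Fin 2 → ℝ)
    (hH : ∀ s i, H s i = (1 / 2) * ∑ k : Fin 2, T s k k i) :
    (∑ s : Fin 2, ∑ i : Fin 2, ∑ j : Fin 2, ∑ k : Fin 2, (T s i j k) ^ 2) ≥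
      3 * ∑ s : Fin 2, ∑ i : Fin 2, (H s i) ^ 2 := by
  rw [ge_iff_le, mul_sum]
  refine sum_le_sum fun s _ => ?_
  have h010 : T s 0 1 0 = T s 0 0 1 := hsymm2 s 0 1 0
  have h100 : T s 1 0 0 = T s 0 0 1 := (hsymm1 s 1 0 0).trans h010
  have h101 : T s 1 0 1 = T s 0 1 1 := hsymm1 s 1 0 1
  have h110 : T s 1 1 0 = T s 0 1 1 := (hsymm2 s 1 1 0).trans h101
  simp only [hH, Fin.sum_univ_two, h010, h100, h101, h110]
  linarith [sq_nonneg (T s 0 0 0 - 3 * T s 0 1 1), sq_nonneg (T s 1 1 1 - 3 * T s 0 0 1)]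
end

section
/- Let h : Fin 2 → Fin 2 → Fin 2 → ℝ be totally symmetric (invariant under all permutations of its three indices), with associated symmetric 2×2 matrices h¹_{ij} = h 1 i j and h²_{ij} = h 2 i j. Define S := ∑_{β,i,j} (h β i j)², H^β := (1/2)·∑_i h β i i, H² := ∑_β (H^β)², ρ² := S − 2H², and K := 1 + 2H² − (1/2)S. Then 2K·ρ² − 2·(det h¹ + det h²)² ≥ 2·(1 + H²)·ρ² − (ρ²)² − (1/2)·S². -/
open Finset in
/-- The pointwise estimate `2Kρ² − 2(det h¹ + det h²)² ≥ 2(1+H²)ρ² − ρ⁴ − (1/2)S²`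
for a totally symmetric 3-tensor `h`, where `S` is its squared length,
`H^β = (1/2)∑ᵢ h β i i`, `ρ² = S − 2H²` and `K = 1 + 2H² − S/2`. -/
theorem simons_type_pointwise_estimate
    (h : Fin 2 → Fin 2 → Fin 2 → ℝ)
    (hsymm1 : ∀ a b c, h a b c = h b a c)
    (hsymm2 : ∀ a b c, h a b c = h a c b)
    (S : ℝ) (hS : S = ∑ β : Fin 2, ∑ i : Fin 2, ∑ j : Fin 2, (h β i j) ^ 2)
    (H : Fin 2 → ℝ) (hH : ∀ β, H β = (1 / 2) * ∑ i : Fin 2, h β i i)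
    (H2 : ℝ) (hH2 : H2 = ∑ β : Fin 2, (H β) ^ 2)
    (rho2 : ℝ) (hrho2 : rho2 = S - 2 * H2)
    (K : ℝ) (hK : K = 1 + 2 * H2 - (1 / 2) * S) :
    2 * K * rho2 -
        2 * ((Matrix.of fun i j => h 0 i j).det + (Matrix.of fun i j => h 1 i j).det) ^ 2 ≥
      2 * (1 + H2) * rho2 - rho2 ^ 2 - (1 / 2) * S ^ 2 := by
  have h010 : h 0 1 0 = h 0 0 1 := hsymm2 0 1 0
  have h100 : h 1 0 0 = h 0 0 1 := (hsymm1 1 0 0).trans h010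
  have h101 : h 1 0 1 = h 0 1 1 := hsymm1 1 0 1
  have h110 : h 1 1 0 = h 0 1 1 := (hsymm2 1 1 0).trans h101
  simp only [Fin.sum_univ_two, h010, h100, h101, h110] at hS hH hH2
  have hH2_nonneg : 0 ≤ H2 := by rw [hH2]; positivity
  rw [hH, hH] at hH2
  simp only [h100] at hH2
  have hdet : (Matrix.of fun i j => h 0 i j).det + (Matrix.of fun i j => h 1 i j).det =
      (4 * H2 - S) / 2 := by
    simp only [Matrix.det_fin_two, Matrix.of_apply, h010, h100, h101, h110]
    rw [hH2, hS]
    ring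
  have hrho2_nonneg : 0 ≤ rho2 := by
    rw [hrho2, hS, hH2]
    linarith [sq_nonneg (h 0 0 0 - h 0 1 1), sq_nonneg (h 0 0 1 - h 1 1 1),
      sq_nonneg (h 0 0 1), sq_nonneg (h 0 1 1)]
  have hdiff : 2 * K * rho2 - 2 * ((4 * H2 - S) / 2) ^ 2 -
      (2 * (1 + H2) * rho2 - rho2 ^ 2 - (1 / 2) * S ^ 2) = 4 * (H2 * rho2) := by
    rw [hK, hrho2]
    ring
  rw [hdet]
  linarith [mul_nonneg hH2_nonneg hrho2_nonneg]
end
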